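/- arXiv:0801.0504 — 7 statements merged into one kernel-verified Lean document; each statement's English description precedes it below -/
import Mathlib

section
/- Let (L,T,R) be a quantum triad. Then Q₁ is a quantale. Precisely: (i) if (α,β) and (α',β') belong to Q₁ then so does (α'∘α, β∘β'); (ii) Q₁ is closed under componentwise pointwise suprema, so it is a complete lattice in the componentwise pointwise order; (iii) the multiplication (α,β)·(α',β') = (α'∘α, β∘β') is associative and preserves arbitrary suprema in each variable. -/
/-- A quantum triad `(L,T,R)`: a quantale `T`, a left `T`-module `L`,
a right `T`-module `R`, and a pairing `L × R → T`, all bimorphisms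
(preserving arbitrary suprema in each variable) and satisfying the five
associative laws (TTT, TTL, RTT, LRT, TLR). -/
structure Triad (L T R : Type*)
    [CompleteLattice L] [CompleteLattice T] [CompleteLattice R] where
  tmul : T → T → T
  smulL : T → L → L
  smulR : R → T → R
  pair : L → R → T
  tmul_sSup_left : ∀ (s : Set T) (b : T), tmul (sSup s) b = ⨆ a ∈ s, tmul a b
  tmul_sSup_right : ∀ (a : T) (s : Set T), tmul a (sSup s) = ⨆ b ∈ s, tmul a b
  smulL_sSup_left : ∀ (s : Set T) (l : L), smulL (sSup s) l = ⨆ t ∈ s, smulL t l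
  smulL_sSup_right : ∀ (t : T) (s : Set L), smulL t (sSup s) = ⨆ l ∈ s, smulL t l
  smulR_sSup_left : ∀ (s : Set R) (t : T), smulR (sSup s) t = ⨆ r ∈ s, smulR r t
  smulR_sSup_right : ∀ (r : R) (s : Set T), smulR r (sSup s) = ⨆ t ∈ s, smulR r t
  pair_sSup_left : ∀ (s : Set L) (r : R), pair (sSup s) r = ⨆ l ∈ s, pair l r
  pair_sSup_right : ∀ (l : L) (s : Set R), pair l (sSup s) = ⨆ r ∈ s, pair l r
  tmul_assoc : ∀ a b c : T, tmul (tmul a b) c = tmul a (tmul b c)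
  smulL_assoc : ∀ (t t' : T) (l : L), smulL (tmul t t') l = smulL t (smulL t' l)
  smulR_assoc : ∀ (r : R) (t t' : T), smulR (smulR r t) t' = smulR r (tmul t t')
  pair_smulR : ∀ (l : L) (r : R) (t : T), tmul (pair l r) t = pair l (smulR r t)
  smulL_pair : ∀ (t : T) (l : L) (r : R), pair (smulL t l) r = tmul t (pair l r)

variable {L T R : Type*} [CompleteLattice L] [CompleteLattice T] [CompleteLattice R]

/-- `Q₁`: pairs `(α,β)` of suprema-preserving `T`-equivariant endomaps of `L`
resp. `R` satisfying `α(l)·r = l·β(r)`. -/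
def Triad.Q1 (τ : Triad L T R) : Set ((L → L) × (R → R)) :=
  fun p =>
    (∀ s : Set L, p.1 (sSup s) = ⨆ l ∈ s, p.1 l) ∧
    (∀ (t : T) (l : L), p.1 (τ.smulL t l) = τ.smulL t (p.1 l)) ∧
    (∀ s : Set R, p.2 (sSup s) = ⨆ r ∈ s, p.2 r) ∧
    (∀ (r : R) (t : T), p.2 (τ.smulR r t) = τ.smulR (p.2 r) t) ∧
    (∀ (l : L) (r : R), τ.pair (p.1 l) r = τ.pair l (p.2 r))

/-- Multiplication on `Q₁`: `(α,β)·(α',β') = (α'∘α, β∘β')`. -/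
def q1mul (p q : (L → L) × (R → R)) : (L → L) × (R → R) :=
  (q.1 ∘ p.1, p.2 ∘ q.2)

/-- `⟨r,l⟩ = (l' ↦ (l'·r)·l, r' ↦ r·(l·r'))`. -/
def Triad.rl (τ : Triad L T R) (r : R) (l : L) : (L → L) × (R → R) :=
  (fun l' => τ.smulL (τ.pair l' r) l, fun r' => τ.smulR r (τ.pair l r'))

/-- Componentwise pointwise supremum of a family of pairs. -/
def ptSup {ι : Sort*} (f : ι → (L → L) × (R → R)) : (L → L) × (R → R) :=
  (fun l => ⨆ i, (f i).1 l, fun r => ⨆ i, (f i).2 r)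

theorem map_iSup_of_map_sSup {A B : Type*} [CompleteLattice A] [CompleteLattice B] {f : A → B}
    (hf : ∀ s : Set A, f (sSup s) = ⨆ a ∈ s, f a) {ι : Sort*} (g : ι → A) :
    f (⨆ i, g i) = ⨆ i, f (g i) := by
  rw [iSup, hf, iSup_range]

theorem map_sSup_comp {A B C : Type*} [CompleteLattice A] [CompleteLattice B] [CompleteLattice C]
    {f : A → B} {g : B → C} (hf : ∀ s : Set A, f (sSup s) = ⨆ a ∈ s, f a)
    (hg : ∀ s : Set B, g (sSup s) = ⨆ b ∈ s, g b) (s : Set A) :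
    g (f (sSup s)) = ⨆ a ∈ s, g (f a) := by
  simp only [hf, map_iSup_of_map_sSup hg]

theorem map_sSup_iSup {A B : Type*} [CompleteLattice A] [CompleteLattice B] {ι : Sort*}
    {f : ι → A → B} (hf : ∀ i, ∀ s : Set A, f i (sSup s) = ⨆ a ∈ s, f i a) (s : Set A) :
    ⨆ i, f i (sSup s) = ⨆ a ∈ s, ⨆ i, f i a := by
  simp only [hf]
  rw [iSup_comm]
  exact iSup_congr fun a => iSup_comm

theorem Triad.q1mul_mem_Q1 (τ : Triad L T R) {p q : (L → L) × (R → R)} (hp : p ∈ τ.Q1)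
    (hq : q ∈ τ.Q1) : q1mul p q ∈ τ.Q1 := by
  obtain ⟨p1, p2, p3, p4, p5⟩ := hp
  obtain ⟨q1, q2, q3, q4, q5⟩ := hq
  refine ⟨map_sSup_comp p1 q1, fun t l => ?_, map_sSup_comp q3 p3, fun r t => ?_, fun l r => ?_⟩
  · simp only [q1mul, Function.comp_apply, p2, q2]
  · simp only [q1mul, Function.comp_apply, p4, q4]
  · simp only [q1mul, Function.comp_apply, p5, q5]

theorem Triad.ptSup_mem_Q1 (τ : Triad L T R) {ι : Sort*} {f : ι → (L → L) × (R → R)}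
    (hf : ∀ i, f i ∈ τ.Q1) : ptSup f ∈ τ.Q1 := by
  refine ⟨map_sSup_iSup fun i => (hf i).1, fun t l => ?_, map_sSup_iSup fun i => (hf i).2.2.1,
    fun r t => ?_, fun l r => ?_⟩
  · simp only [ptSup, map_iSup_of_map_sSup (τ.smulL_sSup_right t), (hf _).2.1]
  · simp only [ptSup, map_iSup_of_map_sSup (f := fun r => τ.smulR r t)
      (fun s => τ.smulR_sSup_left s t), (hf _).2.2.2.1]
  · simp only [ptSup, map_iSup_of_map_sSup (f := fun l => τ.pair l r)
      (fun s => τ.pair_sSup_left s r), map_iSup_of_map_sSup (τ.pair_sSup_right l),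
      (hf _).2.2.2.2]

theorem isLUB_range_ptSup {ι : Sort*} (f : ι → (L → L) × (R → R)) :
    IsLUB (Set.range f) (ptSup f) := by
  constructor
  · rintro _ ⟨i, rfl⟩
    exact ⟨fun l => le_iSup (fun i => (f i).1 l) i, fun r => le_iSup (fun i => (f i).2 r) i⟩
  · intro u hu
    exact ⟨fun l => iSup_le fun i => (hu ⟨i, rfl⟩).1 l, fun r => iSup_le fun i => (hu ⟨i, rfl⟩).2 r⟩

/-- `Q₁` is a quantale: it is closed under the multiplication
`(α,β)·(α',β') = (α'∘α, β∘β')`, closed under componentwise pointwise suprema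
(which are least upper bounds, so `Q₁` is a complete lattice in the
componentwise pointwise order), and the multiplication is associative and
preserves arbitrary suprema in each variable. -/
theorem stmt0 (τ : Triad L T R) :
    (∀ p ∈ τ.Q1, ∀ q ∈ τ.Q1, q1mul p q ∈ τ.Q1) ∧
    (∀ {ι : Type*} (f : ι → (L → L) × (R → R)), (∀ i, f i ∈ τ.Q1) →
      ptSup f ∈ τ.Q1 ∧ IsLUB (Set.range f) (ptSup f)) ∧
    (∀ p q r' : (L → L) × (R → R),
      q1mul (q1mul p q) r' = q1mul p (q1mul q r')) ∧
    (∀ {ι : Type*} (f : ι → (L → L) × (R → R)), (∀ i, f i ∈ τ.Q1) →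
      ∀ q ∈ τ.Q1,
        q1mul (ptSup f) q = ptSup (fun i => q1mul (f i) q) ∧
        q1mul q (ptSup f) = ptSup (fun i => q1mul q (f i))) := by
  refine ⟨fun p hp q hq => τ.q1mul_mem_Q1 hp hq,
    fun f hf => ⟨τ.ptSup_mem_Q1 hf, isLUB_range_ptSup f⟩, fun _ _ _ => rfl,
    fun f _ q hq => ⟨Prod.ext (funext fun l => ?_) rfl, Prod.ext rfl (funext fun r => ?_)⟩⟩
  · exact map_iSup_of_map_sSup hq.1 fun i => (f i).1 l
  · exact map_iSup_of_map_sSup hq.2.2.1 fun i => (f i).2 r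
end

section
/- Let (L,T,R) be a quantum triad. For every r ∈ R and l ∈ L, the pair ⟨r,l⟩ = (l' ↦ (l'·r)·l, r' ↦ r·(l·r')) belongs to Q₁; that is, both maps preserve arbitrary suprema, the first satisfies (t·l')·r·l = t·((l'·r)·l), the second satisfies r·(l·(r'·t)) = (r·(l·r'))·t, and ((l'·r)·l)·r' = l'·(r·(l·r')) for all l' ∈ L, r' ∈ R, t ∈ T. -/
variable {L T R : Type*} [CompleteLattice L] [CompleteLattice T] [CompleteLattice R]

/-- For every `r ∈ R`, `l ∈ L`, the pair `⟨r,l⟩ = (l' ↦ (l'·r)·l, r' ↦ r·(l·r'))`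
belongs to `Q₁`: both maps preserve arbitrary suprema, they are `T`-equivariant,
and `((l'·r)·l)·r' = l'·(r·(l·r'))`. -/
theorem stmt1 (τ : Triad L T R) (r : R) (l : L) : τ.rl r l ∈ τ.Q1 := by
  refine ⟨fun s => ?_, fun t l' => ?_, fun s => ?_, fun r' t => ?_, fun l' r' => ?_⟩ <;>
    dsimp only [Triad.rl]
  · rw [τ.pair_sSup_left, ← sSup_image, τ.smulL_sSup_left, iSup_image]
  · rw [τ.smulL_pair, τ.smulL_assoc]
  · rw [τ.pair_sSup_right, ← sSup_image, τ.smulR_sSup_right, iSup_image]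
  · rw [← τ.pair_smulR, τ.smulR_assoc]
  · rw [τ.smulL_pair, τ.pair_smulR]
end

section
/- Let (L,T,R) be a strict quantum triad. Then the map r ↦ ⟨r, ⊤_L⟩ is an order-isomorphism from R onto the set of right-sided elements of Q₁, namely {ρ ∈ Q₁ : ρ·⊤_{Q₁} ≤ ρ}, with inverse (α,β) ↦ β(⊤_R); and dually, the map l ↦ ⟨⊤_R, l⟩ is an order-isomorphism from L onto the set of left-sided elements {λ ∈ Q₁ : ⊤_{Q₁}·λ ≤ λ}, with inverse (α,β) ↦ α(⊤_L). (Here ⊤_{Q₁} is the greatest element of Q₁.) -/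
variable {L T R : Type*} [CompleteLattice L] [CompleteLattice T] [CompleteLattice R]

/-- The triad is strong if `l ≤ (l·⊤_R)·⊤_L` and `r ≤ ⊤_R·(⊤_L·r)`. -/
def Triad.Strong (τ : Triad L T R) : Prop :=
  (∀ l : L, l ≤ τ.smulL (τ.pair l ⊤) ⊤) ∧ (∀ r : R, r ≤ τ.smulR ⊤ (τ.pair ⊤ r))

/-- `e` is a unit for the triad: a unit of `T` acting unitally on `L` and `R`. -/
def Triad.IsTriadUnit (τ : Triad L T R) (e : T) : Prop :=
  (∀ t : T, τ.tmul e t = t) ∧ (∀ t : T, τ.tmul t e = t) ∧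
  (∀ l : L, τ.smulL e l = l) ∧ (∀ r : R, τ.smulR r e = r)

/-- The triad is strict (with unit `e`): strong, unital, and `⊤_L·⊤_R = e`. -/
def Triad.Strict (τ : Triad L T R) (e : T) : Prop :=
  τ.Strong ∧ τ.IsTriadUnit e ∧ τ.pair ⊤ ⊤ = e

/-- The greatest element of `Q₁` (the componentwise pointwise supremum of `Q₁`). -/
def Triad.Q1Top (τ : Triad L T R) : (L → L) × (R → R) :=
  (fun l => ⨆ p ∈ τ.Q1, p.1 l, fun r => ⨆ p ∈ τ.Q1, p.2 r)

namespace Triad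

theorem monotone_of_map_sSup {X Y : Type*} [CompleteLattice X] [CompleteLattice Y] {f : X → Y}
    (hf : ∀ s : Set X, f (sSup s) = ⨆ x ∈ s, f x) : Monotone f := by
  intro a b hab
  have h := hf {a, b}
  rw [sSup_pair, sup_eq_right.2 hab, iSup_pair] at h
  exact h ▸ le_sup_left

theorem smulL_mono (τ : Triad L T R) {t t' : T} {l l' : L} (ht : t ≤ t') (hl : l ≤ l') :
    τ.smulL t l ≤ τ.smulL t' l' :=
  (monotone_of_map_sSup (f := (τ.smulL · l)) (τ.smulL_sSup_left · l) ht).trans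
    (monotone_of_map_sSup (τ.smulL_sSup_right t') hl)

theorem smulR_mono (τ : Triad L T R) {r r' : R} {t t' : T} (hr : r ≤ r') (ht : t ≤ t') :
    τ.smulR r t ≤ τ.smulR r' t' :=
  (monotone_of_map_sSup (f := (τ.smulR · t)) (τ.smulR_sSup_left · t) hr).trans
    (monotone_of_map_sSup (τ.smulR_sSup_right r') ht)

theorem pair_mono (τ : Triad L T R) {l l' : L} {r r' : R} (hl : l ≤ l') (hr : r ≤ r') :
    τ.pair l r ≤ τ.pair l' r' :=
  (monotone_of_map_sSup (f := (τ.pair · r)) (τ.pair_sSup_left · r) hl).trans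
    (monotone_of_map_sSup (τ.pair_sSup_right l') hr)

theorem rl_mem_Q1 (τ : Triad L T R) (r : R) (l : L) : τ.rl r l ∈ τ.Q1 := by
  refine ⟨fun s => ?_, fun t l' => ?_, fun s => ?_, fun r' t => ?_, fun l' r' => ?_⟩ <;>
    simp only [rl]
  · rw [τ.pair_sSup_left, ← sSup_image, τ.smulL_sSup_left, iSup_image]
  · rw [τ.smulL_pair, τ.smulL_assoc]
  · rw [τ.pair_sSup_right, ← sSup_image, τ.smulR_sSup_right, iSup_image]
  · rw [← τ.pair_smulR, τ.smulR_assoc]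
  · rw [τ.smulL_pair, τ.pair_smulR]

theorem rl_mono (τ : Triad L T R) {r r' : R} {l l' : L} (hr : r ≤ r') (hl : l ≤ l') :
    τ.rl r l ≤ τ.rl r' l' :=
  ⟨fun _ => τ.smulL_mono (τ.pair_mono le_rfl hr) hl,
    fun _ => τ.smulR_mono hr (τ.pair_mono hl le_rfl)⟩

theorem le_Q1Top (τ : Triad L T R) {p : (L → L) × (R → R)} (hp : p ∈ τ.Q1) : p ≤ τ.Q1Top :=
  ⟨fun l => le_iSup₂ (f := fun (p : (L → L) × (R → R)) (_ : p ∈ τ.Q1) => p.1 l) p hp,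
    fun r => le_iSup₂ (f := fun (p : (L → L) × (R → R)) (_ : p ∈ τ.Q1) => p.2 r) p hp⟩

theorem Q1Top_smulL_top_le (τ : Triad L T R) (t : T) :
    τ.Q1Top.1 (τ.smulL t ⊤) ≤ τ.smulL t ⊤ :=
  iSup₂_le fun p hp => by
    rw [hp.2.1]
    exact τ.smulL_mono le_rfl le_top

theorem Q1Top_smulR_top_le (τ : Triad L T R) (t : T) :
    τ.Q1Top.2 (τ.smulR ⊤ t) ≤ τ.smulR ⊤ t :=
  iSup₂_le fun p hp => by
    rw [hp.2.2.2.1]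
    exact τ.smulR_mono le_top le_rfl

theorem pair_top_Q1Top_le (τ : Triad L T R) (r : R) :
    τ.pair ⊤ (τ.Q1Top.2 r) ≤ τ.pair ⊤ r := by
  simp only [Q1Top]
  rw [← sSup_image, τ.pair_sSup_right, iSup_image]
  refine iSup₂_le fun p hp => ?_
  rw [← hp.2.2.2.2]
  exact τ.pair_mono le_top le_rfl

theorem pair_Q1Top_top_le (τ : Triad L T R) (l : L) :
    τ.pair (τ.Q1Top.1 l) ⊤ ≤ τ.pair l ⊤ := by
  simp only [Q1Top]
  rw [← sSup_image, τ.pair_sSup_left, iSup_image]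
  refine iSup₂_le fun p hp => ?_
  rw [hp.2.2.2.2]
  exact τ.pair_mono le_rfl le_top

theorem rl_top_right_isRightSided (τ : Triad L T R) (r : R) :
    q1mul (τ.rl r ⊤) τ.Q1Top ≤ τ.rl r ⊤ :=
  ⟨fun _ => τ.Q1Top_smulL_top_le _,
    fun r' => τ.smulR_mono le_rfl (τ.pair_top_Q1Top_le r')⟩

theorem rl_top_left_isLeftSided (τ : Triad L T R) (l : L) :
    q1mul τ.Q1Top (τ.rl ⊤ l) ≤ τ.rl ⊤ l :=
  ⟨fun l' => τ.smulL_mono (τ.pair_Q1Top_top_le l') le_rfl,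
    fun _ => τ.Q1Top_smulR_top_le _⟩

theorem Strict.rl_snd_top {τ : Triad L T R} {e : T} (h : τ.Strict e) (r : R) :
    (τ.rl r ⊤).2 ⊤ = r := by
  obtain ⟨-, ⟨-, -, -, he⟩, htop⟩ := h
  simp only [rl, htop, he]

theorem Strict.rl_fst_top {τ : Triad L T R} {e : T} (h : τ.Strict e) (l : L) :
    (τ.rl ⊤ l).1 ⊤ = l := by
  obtain ⟨-, ⟨-, -, he, -⟩, htop⟩ := h
  simp only [rl, htop, he]

theorem Strong.rl_snd_top_of_isRightSided {τ : Triad L T R} (h : τ.Strong)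
    {p : (L → L) × (R → R)} (hp : p ∈ τ.Q1) (hr : q1mul p τ.Q1Top ≤ p) :
    τ.rl (p.2 ⊤) ⊤ = p := by
  have htop := τ.le_Q1Top (τ.rl_mem_Q1 ⊤ ⊤)
  obtain ⟨-, -, hsup, hsmul, hpair⟩ := hp
  refine Prod.ext (funext fun l => ?_) (funext fun r => ?_)
  · simp only [rl, ← hpair]
    exact le_antisymm ((htop.1 _).trans (hr.1 l)) (h.1 _)
  · simp only [rl, ← hsmul]
    exact le_antisymm ((monotone_of_map_sSup hsup (htop.2 r)).trans (hr.2 r))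
      (monotone_of_map_sSup hsup (h.2 r))

theorem Strong.rl_fst_top_of_isLeftSided {τ : Triad L T R} (h : τ.Strong)
    {p : (L → L) × (R → R)} (hp : p ∈ τ.Q1) (hl : q1mul τ.Q1Top p ≤ p) :
    τ.rl ⊤ (p.1 ⊤) = p := by
  have htop := τ.le_Q1Top (τ.rl_mem_Q1 ⊤ ⊤)
  obtain ⟨hsup, hsmul, -, -, hpair⟩ := hp
  refine Prod.ext (funext fun l => ?_) (funext fun r => ?_)
  · simp only [rl, ← hsmul]
    exact le_antisymm ((monotone_of_map_sSup hsup (htop.1 l)).trans (hl.1 l))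
      (monotone_of_map_sSup hsup (h.1 l))
  · simp only [rl, hpair]
    exact le_antisymm ((htop.2 _).trans (hl.2 r)) (h.2 _)

end Triad

/-- For a strict triad, `r ↦ ⟨r,⊤_L⟩` is an order-isomorphism from `R` onto the
right-sided elements `{ρ ∈ Q₁ : ρ·⊤_{Q₁} ≤ ρ}` of `Q₁`, with inverse
`(α,β) ↦ β(⊤_R)`; dually `l ↦ ⟨⊤_R,l⟩` is an order-isomorphism from `L` onto
the left-sided elements `{λ ∈ Q₁ : ⊤_{Q₁}·λ ≤ λ}`, with inverse `(α,β) ↦ α(⊤_L)`. -/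
theorem stmt6 (τ : Triad L T R) (e : T) (h : τ.Strict e) :
    (∀ r : R, τ.rl r ⊤ ∈ τ.Q1 ∧ q1mul (τ.rl r ⊤) τ.Q1Top ≤ τ.rl r ⊤) ∧
    (∀ r r' : R, r ≤ r' ↔ τ.rl r ⊤ ≤ τ.rl r' ⊤) ∧
    (∀ r : R, (τ.rl r ⊤).2 ⊤ = r) ∧
    (∀ p ∈ τ.Q1, q1mul p τ.Q1Top ≤ p → τ.rl (p.2 ⊤) ⊤ = p) ∧
    (∀ l : L, τ.rl ⊤ l ∈ τ.Q1 ∧ q1mul τ.Q1Top (τ.rl ⊤ l) ≤ τ.rl ⊤ l) ∧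
    (∀ l l' : L, l ≤ l' ↔ τ.rl ⊤ l ≤ τ.rl ⊤ l') ∧
    (∀ l : L, (τ.rl ⊤ l).1 ⊤ = l) ∧
    (∀ p ∈ τ.Q1, q1mul τ.Q1Top p ≤ p → τ.rl ⊤ (p.1 ⊤) = p) := by
  have hs : τ.Strong := h.1
  refine ⟨fun r => ⟨τ.rl_mem_Q1 r ⊤, τ.rl_top_right_isRightSided r⟩,
    fun r r' => ⟨fun hr => τ.rl_mono hr le_rfl, fun hr => ?_⟩, h.rl_snd_top,
    fun _ hp hr => hs.rl_snd_top_of_isRightSided hp hr,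
    fun l => ⟨τ.rl_mem_Q1 ⊤ l, τ.rl_top_left_isLeftSided l⟩,
    fun l l' => ⟨fun hl => τ.rl_mono le_rfl hl, fun hl => ?_⟩, h.rl_fst_top,
    fun _ hp hl => hs.rl_fst_top_of_isLeftSided hp hl⟩
  · simpa only [h.rl_snd_top] using hr.2 ⊤
  · simpa only [h.rl_fst_top] using hl.1 ⊤
end

section
/- Let (L,T,R) be a strict quantum triad. Define Θ : T → Q₁ by Θ(t) = (l ↦ (l·(⊤_R·t))·⊤_L, r ↦ ⊤_R·(t·(⊤_L·r))). Then Θ is well defined (each Θ(t) lies in Q₁), is a bijection from T onto the set of two-sided elements of Q₁, namely {q ∈ Q₁ : q·⊤_{Q₁} ≤ q and ⊤_{Q₁}·q ≤ q}, preserves arbitrary suprema, and is multiplicative: Θ(t·t') = Θ(t)·Θ(t') for all t, t' ∈ T. Its inverse sends (α,β) to ⊤_L·β(⊤_R). -/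
variable {L T R : Type*} [CompleteLattice L] [CompleteLattice T] [CompleteLattice R]

/-- `Θ(t) = (l ↦ (l·(⊤_R·t))·⊤_L, r ↦ ⊤_R·(t·(⊤_L·r)))`. -/
def theta (τ : Triad L T R) (t : T) : (L → L) × (R → R) :=
  (fun l => τ.smulL (τ.pair l (τ.smulR ⊤ t)) ⊤,
   fun r => τ.smulR ⊤ (τ.tmul t (τ.pair ⊤ r)))

theorem map_biSup_of_map_sSup {A B ι : Type*} [CompleteLattice A] [CompleteLattice B] {f : A → B}
    (hf : ∀ s : Set A, f (sSup s) = ⨆ a ∈ s, f a) (s : Set ι) (g : ι → A) :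
    f (⨆ i ∈ s, g i) = ⨆ i ∈ s, f (g i) := by
  rw [← sSup_image, hf, iSup_image]

theorem monotone_of_map_sSup {A B : Type*} [CompleteLattice A] [CompleteLattice B] {f : A → B}
    (hf : ∀ s : Set A, f (sSup s) = ⨆ a ∈ s, f a) : Monotone f := by
  intro a b hab
  have key := hf {a, b}
  rw [sSup_pair, sup_eq_right.mpr hab, iSup_pair] at key
  exact key ▸ le_sup_left

namespace Triad

variable (τ : Triad L T R)

theorem theta_sSup (s : Set T) : theta τ (sSup s) =
    (fun l => ⨆ t ∈ s, (theta τ t).1 l, fun r => ⨆ t ∈ s, (theta τ t).2 r) := by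
  refine Prod.ext (funext fun l => ?_) (funext fun r => ?_)
  · simp only [theta]
    rw [τ.smulR_sSup_right, map_biSup_of_map_sSup (τ.pair_sSup_right l),
      map_biSup_of_map_sSup (f := fun t => τ.smulL t ⊤) (τ.smulL_sSup_left · ⊤)]
  · simp only [theta]
    rw [τ.tmul_sSup_left, map_biSup_of_map_sSup (τ.smulR_sSup_right ⊤)]

theorem theta_mem_Q1 (t : T) : theta τ t ∈ τ.Q1 := by
  refine ⟨fun s => ?_, fun a l => ?_, fun s => ?_, fun r a => ?_, fun l r => ?_⟩
  · simp only [theta]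
    rw [τ.pair_sSup_left,
      map_biSup_of_map_sSup (f := fun t => τ.smulL t ⊤) (τ.smulL_sSup_left · ⊤)]
  · simp only [theta, τ.smulL_pair, τ.smulL_assoc]
  · simp only [theta]
    rw [τ.pair_sSup_right, map_biSup_of_map_sSup (τ.tmul_sSup_right t),
      map_biSup_of_map_sSup (τ.smulR_sSup_right ⊤)]
  · simp only [theta, ← τ.pair_smulR, τ.smulR_assoc, τ.tmul_assoc]
  · simp only [theta, τ.smulL_pair, ← τ.pair_smulR, τ.tmul_assoc]

variable {τ} {e : T}

theorem IsTriadUnit.theta_unit (he : τ.IsTriadUnit e) :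
    theta τ e = τ.rl ⊤ ⊤ := by
  simp only [theta, rl, he.1, he.2.2.2]

theorem Strong.le_rl_top (hs : τ.Strong) {p : (L → L) × (R → R)} (hp : p ∈ τ.Q1) :
    p ≤ τ.rl ⊤ ⊤ := by
  obtain ⟨-, -, -, -, h⟩ := hp
  refine ⟨fun l => (hs.1 _).trans ?_, fun r => (hs.2 _).trans ?_⟩
  · rw [h]
    exact monotone_of_map_sSup (f := fun t => τ.smulL t ⊤) (τ.smulL_sSup_left · ⊤)
      (monotone_of_map_sSup (τ.pair_sSup_right l) le_top)
  · rw [← h]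
    exact monotone_of_map_sSup (τ.smulR_sSup_right ⊤)
      (monotone_of_map_sSup (f := fun l => τ.pair l r) (τ.pair_sSup_left · r) le_top)

theorem Strict.Q1Top_eq_rl (h : τ.Strict e) : τ.Q1Top = τ.rl ⊤ ⊤ := by
  have hmem : τ.rl ⊤ ⊤ ∈ τ.Q1 := h.2.1.theta_unit ▸ theta_mem_Q1 τ e
  apply le_antisymm
  · exact ⟨fun l => iSup₂_le fun p hp => (h.1.le_rl_top hp).1 l,
      fun r => iSup₂_le fun p hp => (h.1.le_rl_top hp).2 r⟩
  · exact ⟨fun l => le_iSup₂ (f := fun p (_ : p ∈ τ.Q1) => p.1 l) _ hmem,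
      fun r => le_iSup₂ (f := fun p (_ : p ∈ τ.Q1) => p.2 r) _ hmem⟩

theorem Strict.Q1Top_eq_theta (h : τ.Strict e) : τ.Q1Top = theta τ e :=
  h.Q1Top_eq_rl.trans h.2.1.theta_unit.symm

theorem Strict.theta_tmul (h : τ.Strict e) (t t' : T) :
    theta τ (τ.tmul t t') = q1mul (theta τ t) (theta τ t') := by
  obtain ⟨-, ⟨he, -⟩, htop⟩ := h
  refine Prod.ext (funext fun l => ?_) (funext fun r => ?_) <;>
    simp only [theta, q1mul, Function.comp_apply, ← τ.pair_smulR, τ.smulL_pair, htop, he,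
      τ.tmul_assoc]

theorem Strict.pair_theta_top (h : τ.Strict e) (t : T) :
    τ.pair ⊤ ((theta τ t).2 ⊤) = t := by
  obtain ⟨-, ⟨he, he', -⟩, htop⟩ := h
  simp only [theta, ← τ.pair_smulR, htop, he, he']

theorem Strict.theta_pair_top (h : τ.Strict e) {p : (L → L) × (R → R)} (hp : p ∈ τ.Q1)
    (hright : q1mul p τ.Q1Top ≤ p) (hleft : q1mul τ.Q1Top p ≤ p) :
    theta τ (τ.pair ⊤ (p.2 ⊤)) = p := by
  rw [h.Q1Top_eq_rl] at hright hleft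
  obtain ⟨hα, hαt, hβ, hβt, hαβ⟩ := hp
  refine Prod.ext (funext fun l => ?_) (funext fun r => ?_)
  · have hA : τ.smulL (τ.pair (p.1 l) ⊤) ⊤ = p.1 l := (hright.1 l).antisymm (h.1.1 _)
    have hA' : p.1 (τ.smulL (τ.pair l ⊤) ⊤) = p.1 l :=
      (hleft.1 l).antisymm (monotone_of_map_sSup hα (h.1.1 l))
    rw [← hA, ← hA', hαt, τ.smulL_pair, hαβ]
    simp only [theta, ← τ.pair_smulR]
  · have hB : τ.smulR ⊤ (τ.pair ⊤ (p.2 r)) = p.2 r := (hleft.2 r).antisymm (h.1.2 _)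
    have hB' : p.2 (τ.smulR ⊤ (τ.pair ⊤ r)) = p.2 r :=
      (hright.2 r).antisymm (monotone_of_map_sSup hβ (h.1.2 r))
    rw [← hB, ← hB', hβt, ← τ.pair_smulR]
    rfl

end Triad

/-- For a strict triad, `Θ : T → Q₁` is well defined, a bijection from `T` onto
the two-sided elements `{q ∈ Q₁ : q·⊤_{Q₁} ≤ q ∧ ⊤_{Q₁}·q ≤ q}` of `Q₁` (with
inverse `(α,β) ↦ ⊤_L·β(⊤_R)`), preserves arbitrary suprema, and is
multiplicative. -/
theorem stmt7 (τ : Triad L T R) (e : T) (h : τ.Strict e) :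
    (∀ t : T, theta τ t ∈ τ.Q1 ∧ q1mul (theta τ t) τ.Q1Top ≤ theta τ t ∧
      q1mul τ.Q1Top (theta τ t) ≤ theta τ t) ∧
    (∀ t : T, τ.pair ⊤ ((theta τ t).2 ⊤) = t) ∧
    (∀ p ∈ τ.Q1, q1mul p τ.Q1Top ≤ p → q1mul τ.Q1Top p ≤ p →
      theta τ (τ.pair ⊤ (p.2 ⊤)) = p) ∧
    (∀ s : Set T, theta τ (sSup s) =
      (fun l => ⨆ t ∈ s, (theta τ t).1 l, fun r => ⨆ t ∈ s, (theta τ t).2 r)) ∧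
    (∀ t t' : T, theta τ (τ.tmul t t') = q1mul (theta τ t) (theta τ t')) := by
  refine ⟨fun t => ⟨τ.theta_mem_Q1 t, ?_, ?_⟩, h.pair_theta_top,
    fun p hp => h.theta_pair_top hp, τ.theta_sSup, h.theta_tmul⟩
  · rw [h.Q1Top_eq_theta, ← h.theta_tmul, h.2.1.2.1]
  · rw [h.Q1Top_eq_theta, ← h.theta_tmul, h.2.1.1]
end

section
/- Let (L,T,R) be an involutive quantum triad. Define, for (α,β) ∈ Q₁, the pair (α,β)* = (l ↦ β(l*)*, r ↦ α(r*)*). Then (α,β)* again lies in Q₁, and this operation is an involution on the quantale Q₁: ((α,β)*)* = (α,β), ((α,β)·(α',β'))* = (α',β')*·(α,β)*, and (⋁ᵢ(αᵢ,βᵢ))* = ⋁ᵢ(αᵢ,βᵢ)* for all elements and families of elements of Q₁. -/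
variable {L T R : Type*} [CompleteLattice L] [CompleteLattice T] [CompleteLattice R]

/-- An involutive triad: the triad together with a suprema-preserving involution
on `T` and mutually inverse suprema-preserving bijections `* : L → R`,
`* : R → L` with `(t·l)* = l*·t*`, `(r·t)* = t*·r*`, `(l·r)* = r*·l*`. -/
structure InvolutiveTriad (L T R : Type*)
    [CompleteLattice L] [CompleteLattice T] [CompleteLattice R]
    extends Triad L T R where
  tstar : T → T
  lstar : L → R
  rstar : R → L
  tstar_sSup : ∀ s : Set T, tstar (sSup s) = ⨆ t ∈ s, tstar t
  tstar_tstar : ∀ t : T, tstar (tstar t) = t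
  tstar_tmul : ∀ t t' : T, tstar (tmul t t') = tmul (tstar t') (tstar t)
  lstar_sSup : ∀ s : Set L, lstar (sSup s) = ⨆ l ∈ s, lstar l
  rstar_sSup : ∀ s : Set R, rstar (sSup s) = ⨆ r ∈ s, rstar r
  rstar_lstar : ∀ l : L, rstar (lstar l) = l
  lstar_rstar : ∀ r : R, lstar (rstar r) = r
  star_smulL : ∀ (t : T) (l : L), lstar (smulL t l) = smulR (lstar l) (tstar t)
  star_smulR : ∀ (r : R) (t : T), rstar (smulR r t) = smulL (tstar t) (rstar r)
  star_pair : ∀ (l : L) (r : R), tstar (pair l r) = pair (rstar r) (lstar l)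

/-- `(α,β)* = (l ↦ β(l*)*, r ↦ α(r*)*)`. -/
def q1star (J : InvolutiveTriad L T R) (p : (L → L) × (R → R)) :
    (L → L) × (R → R) :=
  (fun l => J.rstar (p.2 (J.lstar l)), fun r => J.lstar (p.1 (J.rstar r)))

theorem InvolutiveTriad.tstar_injective (J : InvolutiveTriad L T R) :
    Function.Injective J.tstar :=
  Function.LeftInverse.injective J.tstar_tstar

theorem q1star_mem_Q1 (J : InvolutiveTriad L T R) {p : (L → L) × (R → R)}
    (hp : p ∈ J.toTriad.Q1) : q1star J p ∈ J.toTriad.Q1 := by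
  obtain ⟨hα, hαt, hβ, hβt, hpair⟩ := hp
  refine ⟨fun s => ?_, fun t l => ?_, fun s => ?_, fun r t => ?_, fun l r => ?_⟩
  · simp only [q1star, J.lstar_sSup, map_iSup_of_map_sSup hβ, map_iSup_of_map_sSup J.rstar_sSup]
  · simp only [q1star, J.star_smulL, hβt, J.star_smulR, J.tstar_tstar]
  · simp only [q1star, J.rstar_sSup, map_iSup_of_map_sSup hα, map_iSup_of_map_sSup J.lstar_sSup]
  · simp only [q1star, J.star_smulR, hαt, J.star_smulL, J.tstar_tstar]
  · apply J.tstar_injective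
    simp only [q1star, J.star_pair, J.lstar_rstar, J.rstar_lstar, hpair]

/-- For an involutive triad, `(α,β) ↦ (α,β)*` maps `Q₁` to itself and is an
involution on the quantale `Q₁`: `p** = p`, `(p·p')* = p'*·p*`, and it
preserves arbitrary (componentwise pointwise) suprema of elements of `Q₁`. -/
theorem stmt9 (J : InvolutiveTriad L T R) :
    (∀ p ∈ J.toTriad.Q1, q1star J p ∈ J.toTriad.Q1) ∧
    (∀ p ∈ J.toTriad.Q1, q1star J (q1star J p) = p) ∧
    (∀ p ∈ J.toTriad.Q1, ∀ p' ∈ J.toTriad.Q1,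
      q1star J (q1mul p p') = q1mul (q1star J p') (q1star J p)) ∧
    (∀ {ι : Type*} (f : ι → (L → L) × (R → R)), (∀ i, f i ∈ J.toTriad.Q1) →
      q1star J (ptSup f) = ptSup (fun i => q1star J (f i))) := by
  refine ⟨fun p hp => q1star_mem_Q1 J hp, fun p _ => ?_, fun p _ p' _ => ?_, fun f _ => ?_⟩
  · simp only [q1star, J.lstar_rstar, J.rstar_lstar]
  · ext x <;> simp only [q1star, q1mul, Function.comp_apply, J.lstar_rstar, J.rstar_lstar]
  · simp only [q1star, ptSup, map_iSup_of_map_sSup J.lstar_sSup,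
      map_iSup_of_map_sSup J.rstar_sSup]
end

section
/- Let (L,T,R) be a strict Girard quantum triad. Then Q₁ is strictly faithful in the following sense: if (α,β) and (α',β') are elements of Q₁ such that l·β(r) = l·β'(r) for all l ∈ L and r ∈ R, then α = α' and β = β'. -/
variable {L T R : Type*} [CompleteLattice L] [CompleteLattice T] [CompleteLattice R]

/-- `l^⊥ = ⋁{r : l·r ≤ d}`. -/
def lperp (τ : Triad L T R) (d : T) (l : L) : R := sSup {r : R | τ.pair l r ≤ d}

/-- `r^⊥ = ⋁{l : l·r ≤ d}`. -/
def rperp (τ : Triad L T R) (d : T) (r : R) : L := sSup {l : L | τ.pair l r ≤ d}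

/-- `d` is a Girard element: cyclic, the pairing is represented by the two perps,
and the perps are mutually inverse. -/
def Triad.GirardElem (τ : Triad L T R) (d : T) : Prop :=
  (∀ t t' : T, τ.tmul t t' ≤ d ↔ τ.tmul t' t ≤ d) ∧
  (∀ (l : L) (r : R), τ.pair l r ≤ d ↔ r ≤ lperp τ d l) ∧
  (∀ (l : L) (r : R), τ.pair l r ≤ d ↔ l ≤ rperp τ d r) ∧
  (∀ l : L, rperp τ d (lperp τ d l) = l) ∧
  (∀ r : R, lperp τ d (rperp τ d r) = r)

/-- In a Girard triad the pairing separates the points of `L`. -/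
theorem Triad.GirardElem.eq_of_pair_eq_left {τ : Triad L T R} {d : T} (hd : τ.GirardElem d)
    {l l' : L} (h : ∀ r, τ.pair l r = τ.pair l' r) : l = l' := by
  rw [← hd.2.2.2.1 l, ← hd.2.2.2.1 l']
  simp only [lperp, h]

/-- In a Girard triad the pairing separates the points of `R`. -/
theorem Triad.GirardElem.eq_of_pair_eq_right {τ : Triad L T R} {d : T} (hd : τ.GirardElem d)
    {r r' : R} (h : ∀ l, τ.pair l r = τ.pair l r') : r = r' := by
  rw [← hd.2.2.2.2 r, ← hd.2.2.2.2 r']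
  simp only [rperp, h]

/-- For a strict Girard triad, `Q₁` is strictly faithful: if `(α,β),(α',β') ∈ Q₁`
satisfy `l·β(r) = l·β'(r)` for all `l`, `r`, then `(α,β) = (α',β')`. -/
theorem stmt12 (τ : Triad L T R) (e : T) (hs : τ.Strict e)
    (d : T) (hd : τ.GirardElem d) :
    ∀ p ∈ τ.Q1, ∀ p' ∈ τ.Q1,
      (∀ (l : L) (r : R), τ.pair l (p.2 r) = τ.pair l (p'.2 r)) →
      p.1 = p'.1 ∧ p.2 = p'.2 := by
  rintro p ⟨-, -, -, -, hp⟩ p' ⟨-, -, -, -, hp'⟩ h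
  refine ⟨funext fun l => hd.eq_of_pair_eq_left fun r => ?_,
    funext fun r => hd.eq_of_pair_eq_right fun l => h l r⟩
  rw [hp, hp', h]
end

section
/- Given a quantale T and a complete lattice L with a left T-action preserving arbitrary suprema in each variable and satisfying (t·t')·l = t·(t'·l), for l, l' ∈ L define π(l,l') ∈ End_T(L) as the pointwise supremum of {α' ∈ End_T(L) : α'(l) ≤ l'}. Then every α ∈ End_T(L) is recovered as the pointwise infimum of the family {π(l,l') : l, l' ∈ L, α(l) ≤ l'}; that is, for every x ∈ L, α(x) = ⋀{π(l,l')(x) : α(l) ≤ l'}. -/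
/-- A quantale `T` together with a complete lattice `L` carrying a left
`T`-action preserving arbitrary suprema in each variable and satisfying
`(t·t')·l = t·(t'·l)`. -/
structure LeftQuantaleModule (T L : Type*) [CompleteLattice T] [CompleteLattice L] where
  tmul : T → T → T
  smul : T → L → L
  tmul_sSup_left : ∀ (s : Set T) (b : T), tmul (sSup s) b = ⨆ a ∈ s, tmul a b
  tmul_sSup_right : ∀ (a : T) (s : Set T), tmul a (sSup s) = ⨆ b ∈ s, tmul a b
  tmul_assoc : ∀ a b c : T, tmul (tmul a b) c = tmul a (tmul b c)
  smul_sSup_left : ∀ (s : Set T) (l : L), smul (sSup s) l = ⨆ t ∈ s, smul t l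
  smul_sSup_right : ∀ (t : T) (s : Set L), smul t (sSup s) = ⨆ l ∈ s, smul t l
  smul_assoc : ∀ (t t' : T) (l : L), smul (tmul t t') l = smul t (smul t' l)

variable {T L : Type*} [CompleteLattice T] [CompleteLattice L]

/-- `End_T(L)`: suprema-preserving `T`-equivariant endomaps of `L`. -/
def EndT (μ : LeftQuantaleModule T L) : Set (L → L) :=
  fun α => (∀ s : Set L, α (sSup s) = ⨆ l ∈ s, α l) ∧
    ∀ (t : T) (l : L), α (μ.smul t l) = μ.smul t (α l)

/-- `π(l,l')`: the pointwise supremum of `{α' ∈ End_T(L) : α'(l) ≤ l'}`. -/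
def piMap (μ : LeftQuantaleModule T L) (l l' : L) : L → L :=
  fun x => ⨆ α ∈ {a ∈ EndT μ | a l ≤ l'}, α x

/-- Every `α ∈ End_T(L)` is the pointwise infimum of the family
`{π(l,l') : α(l) ≤ l'}`. -/
theorem stmt14 (μ : LeftQuantaleModule T L) :
    ∀ α ∈ EndT μ, ∀ x : L,
      α x = ⨅ (l : L) (l' : L) (_ : α l ≤ l'), piMap μ l l' x := by
  intro α hα x
  apply le_antisymm
  · exact le_iInf₂ fun l l' => le_iInf fun h =>
      le_iSup₂ (f := fun (β : L → L) (_ : β ∈ {a ∈ EndT μ | a l ≤ l'}) => β x) α ⟨hα, h⟩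
  · exact (iInf₂_le x (α x)).trans ((iInf_le _ le_rfl).trans (iSup₂_le fun _ hβ => hβ.2))
end
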